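/- Let B₁ ⊂ ℝ² be the open unit ball and let φ_u, φ_v : (−1,1) → ℝ be continuous. Let u, v : B₁ → ℝ be continuous, even in the variable x₂, and solve the thin obstacle problem with obstacles φ_u and φ_v respectively, in the following sense: u is harmonic in B₁ ∖ ({x₂ = 0} ∩ {u = φ_u}), u(x₁,0) ≥ φ_u(x₁) for all x₁ ∈ (−1,1), the one-sided derivative ∂₂u(x₁,0⁺) := lim_{t→0⁺} (u(x₁,t) − u(x₁,0))/t exists and satisfies ∂₂u(x₁,0⁺) ≤ 0 for every x₁ ∈ (−1,1), with ∂₂u(x₁,0⁺) = 0 whenever u(x₁,0) > φ_u(x₁); and the analogous conditions hold for v with obstacle φ_v. Assume φ_u(x₁) ≤ φ_v(x₁) for every x₁ in the contact set {x₁ ∈ (−1,1) : u(x₁,0) = φ_u(x₁)}. Then (u−v)_+ := max(u−v, 0) is subharmonic in B₁, i.e. for every z ∈ B₁ and r > 0 with the closed ball of radius r centered at z contained in B₁, (u−v)_+(z) is at most the average of (u−v)_+ over the sphere ∂B_r(z). -/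

import Mathlib

open MeasureTheory Set

/-- The open unit (Euclidean) ball in `ℝ²`. -/
def ball1 : Set (ℝ × ℝ) := {p | p.1^2 + p.2^2 < 1}

/-- Laplacian of a function on `ℝ²`, computed through iterated coordinate derivatives. -/
noncomputable def lap2 (u : ℝ × ℝ → ℝ) (p : ℝ × ℝ) : ℝ :=
  deriv (deriv (fun t => u (t, p.2))) p.1 + deriv (deriv (fun t => u (p.1, t))) p.2

/-- `u` is harmonic on the open set `U ⊆ ℝ²`: it is `C²` there and its Laplacian vanishes. -/
def HarmonicOn2 (u : ℝ × ℝ → ℝ) (U : Set (ℝ × ℝ)) : Prop :=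
  ContDiffOn ℝ 2 u U ∧ ∀ p ∈ U, lap2 u p = 0

/-- `u` solves the thin obstacle problem in the unit ball `B₁ ⊆ ℝ²` with obstacle `φ`:
it is harmonic away from the contact set `{x₂ = 0} ∩ {u = φ}`, lies above the obstacle on
`{x₂ = 0}`, and the one-sided vertical derivative at `{x₂ = 0}` exists, is `≤ 0`, and
vanishes off the contact set. -/
def ThinObstacleSol (φ : ℝ → ℝ) (u : ℝ × ℝ → ℝ) : Prop :=
  HarmonicOn2 u (ball1 \ {p : ℝ × ℝ | p.2 = 0 ∧ u p = φ p.1}) ∧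
  (∀ x₁ ∈ Set.Ioo (-1:ℝ) 1, φ x₁ ≤ u (x₁, 0)) ∧
  (∀ x₁ ∈ Set.Ioo (-1:ℝ) 1, ∃ L : ℝ,
    Filter.Tendsto (fun t => (u (x₁, t) - u (x₁, 0)) / t) (nhdsWithin 0 (Set.Ioi 0)) (nhds L) ∧
    L ≤ 0 ∧ (φ x₁ < u (x₁, 0) → L = 0))

open Filter Topology

theorem deriv_deriv_nonpos_of_isLocalMax {f : ℝ → ℝ} {a : ℝ} (hf : ContDiffAt ℝ 2 f a)
    (hmax : IsLocalMax f a) : deriv (deriv f) a ≤ 0 := by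
  by_contra! hpos
  have hmin := isLocalMin_of_deriv_deriv_pos hpos hmax.deriv_eq_zero hf.continuousAt
  have hconst : f =ᶠ[𝓝 a] fun _ => f a := by
    filter_upwards [hmax, hmin] with x h₁ h₂ using le_antisymm h₁ h₂
  have hderiv := hconst.deriv.deriv_eq
  simp at hderiv
  exact hpos.ne' hderiv

theorem deriv_deriv_sub {f g : ℝ → ℝ} {a : ℝ} (hf : ContDiffAt ℝ 2 f a)
    (hg : ContDiffAt ℝ 2 g a) :
    deriv (deriv fun t => f t - g t) a = deriv (deriv f) a - deriv (deriv g) a := by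
  have h := iteratedDeriv_fun_sub (n := 2) hf hg
  simpa only [iteratedDeriv_succ, iteratedDeriv_zero] using h

theorem ContDiffAt.slice_fst {f : ℝ × ℝ → ℝ} {p : ℝ × ℝ} (hf : ContDiffAt ℝ 2 f p) :
    ContDiffAt ℝ 2 (fun t => f (t, p.2)) p.1 :=
  ContDiffAt.comp (g := f) (f := fun t : ℝ => (t, p.2)) p.1 hf (by fun_prop)

theorem ContDiffAt.slice_snd {f : ℝ × ℝ → ℝ} {p : ℝ × ℝ} (hf : ContDiffAt ℝ 2 f p) :
    ContDiffAt ℝ 2 (fun t => f (p.1, t)) p.2 :=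
  ContDiffAt.comp (g := f) (f := fun t : ℝ => (p.1, t)) p.2 hf (by fun_prop)

theorem lap2_sub {f g : ℝ × ℝ → ℝ} {p : ℝ × ℝ} (hf : ContDiffAt ℝ 2 f p)
    (hg : ContDiffAt ℝ 2 g p) : lap2 (fun x => f x - g x) p = lap2 f p - lap2 g p := by
  unfold lap2
  rw [deriv_deriv_sub hf.slice_fst hg.slice_fst, deriv_deriv_sub hf.slice_snd hg.slice_snd]
  ring

theorem lap2_nonpos_of_isLocalMax {f : ℝ × ℝ → ℝ} {p : ℝ × ℝ} (hf : ContDiffAt ℝ 2 f p)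
    (hmax : IsLocalMax f p) : lap2 f p ≤ 0 := by
  have h₁ : IsLocalMax (fun t => f (t, p.2)) p.1 :=
    IsLocalMax.comp_continuous (f := f) (g := fun t : ℝ => (t, p.2)) (b := p.1) hmax
      (by fun_prop)
  have h₂ : IsLocalMax (fun t => f (p.1, t)) p.2 :=
    IsLocalMax.comp_continuous (f := f) (g := fun t : ℝ => (p.1, t)) (b := p.2) hmax
      (by fun_prop)
  exact add_nonpos (deriv_deriv_nonpos_of_isLocalMax hf.slice_fst h₁)
    (deriv_deriv_nonpos_of_isLocalMax hf.slice_snd h₂)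

/-- The real part of a complex polynomial, as a function on `ℝ²`. -/
noncomputable def rePoly (Q : Polynomial ℂ) (p : ℝ × ℝ) : ℝ :=
  (Q.eval ((p.1 : ℂ) + p.2 * Complex.I)).re

theorem contDiff_rePoly (Q : Polynomial ℂ) : ContDiff ℝ 2 (rePoly Q) := by
  have hQ : ContDiff ℝ 2 (fun w : ℂ => Q.eval w) :=
    by simpa using (Q.contDiff_aeval (𝕜 := ℂ) (n := 2)).restrict_scalars ℝ
  have hι : ContDiff ℝ 2 (fun p : ℝ × ℝ => (p.1 : ℂ) + p.2 * Complex.I) :=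
    (Complex.ofRealCLM.contDiff.comp contDiff_fst).add
      ((Complex.ofRealCLM.contDiff.comp contDiff_snd).mul contDiff_const)
  exact Complex.reCLM.contDiff.comp (hQ.comp hι)

theorem hasDerivAt_rePoly_fst (Q : Polynomial ℂ) (x y : ℝ) :
    HasDerivAt (fun t => rePoly Q (t, y)) (rePoly Q.derivative (x, y)) x := by
  have h : HasDerivAt (fun w : ℂ => Q.eval (w + y * Complex.I))
      (Q.derivative.eval ((x : ℂ) + y * Complex.I)) (x : ℂ) := by
    simpa using! (Q.hasDerivAt ((x : ℂ) + y * Complex.I)).comp (x : ℂ)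
      ((hasDerivAt_id (x : ℂ)).add_const ((y : ℂ) * Complex.I))
  exact h.real_of_complex

theorem hasDerivAt_rePoly_snd (Q : Polynomial ℂ) (x y : ℝ) :
    HasDerivAt (fun t => rePoly Q (x, t))
      (rePoly (Polynomial.C Complex.I * Q.derivative) (x, y)) y := by
  have h : HasDerivAt (fun w : ℂ => Q.eval ((x : ℂ) + w * Complex.I))
      ((Polynomial.C Complex.I * Q.derivative).eval ((x : ℂ) + y * Complex.I)) (y : ℂ) := by
    simpa [mul_comm] using! (Q.hasDerivAt ((x : ℂ) + y * Complex.I)).comp (y : ℂ)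
      (((hasDerivAt_id (y : ℂ)).mul_const Complex.I).const_add (x : ℂ))
  exact h.real_of_complex

theorem lap2_rePoly (Q : Polynomial ℂ) (p : ℝ × ℝ) : lap2 (rePoly Q) p = 0 := by
  unfold lap2
  have h₁ : deriv (fun t => rePoly Q (t, p.2)) = fun t => rePoly Q.derivative (t, p.2) :=
    funext fun x => (hasDerivAt_rePoly_fst Q x p.2).deriv
  have h₂ : deriv (fun t => rePoly Q (p.1, t)) =
      fun t => rePoly (Polynomial.C Complex.I * Q.derivative) (p.1, t) :=
    funext fun y => (hasDerivAt_rePoly_snd Q p.1 y).deriv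
  rw [h₁, h₂, (hasDerivAt_rePoly_fst _ _ _).deriv, (hasDerivAt_rePoly_snd _ _ _).deriv]
  simp [rePoly, ← mul_assoc]

theorem lap2_quadratic (δ c d a b : ℝ) (p : ℝ × ℝ) :
    lap2 (fun x => δ * ((x.1 - a) ^ 2 + (x.2 - b) ^ 2) + c * x.2 + d) p = 4 * δ := by
  have h₁ : deriv (fun t => δ * ((t - a) ^ 2 + (p.2 - b) ^ 2) + c * p.2 + d) =
      fun t => 2 * δ * (t - a) := by
    funext t
    have := ((((((hasDerivAt_id t).sub_const a).pow 2).add_const ((p.2 - b) ^ 2)).const_mul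
      δ).add_const (c * p.2)).add_const d
    convert! this.deriv using 1
    simp; ring
  have h₂ : deriv (fun t => δ * ((p.1 - a) ^ 2 + (t - b) ^ 2) + c * t + d) =
      fun t => 2 * δ * (t - b) + c := by
    funext t
    have := ((((((hasDerivAt_id t).sub_const b).pow 2).const_add ((p.1 - a) ^ 2)).const_mul
      δ).add ((hasDerivAt_id t).const_mul c)).add_const d
    convert! this.deriv using 1
    simp; ring
  unfold lap2
  simp only [h₁, h₂]
  have h₃ := ((hasDerivAt_id p.1).sub_const a).const_mul (2 * δ)
  have h₄ := (((hasDerivAt_id p.2).sub_const b).const_mul (2 * δ)).add_const c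
  have e₃ := h₃.deriv
  have e₄ := h₄.deriv
  simp only [id] at e₃ e₄
  rw [e₃, e₄]
  ring

/-- If an even `w` has nonnegative right slope at `0`, then `w + η |·| - H` cannot have a local
maximum at `0` when `η > 0` and `H` is differentiable there. -/
theorem not_isLocalMax_of_even {w H : ℝ → ℝ} {L η H' : ℝ} (hη : 0 < η)
    (heven : ∀ t, w (-t) = w t) (hL : 0 ≤ L)
    (hw : Tendsto (fun t => (w t - w 0) / t) (𝓝[>] 0) (𝓝 L)) (hH : HasDerivAt H H' 0) :
    ¬ IsLocalMax (fun t => w t - H t + η * |t|) 0 := by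
  intro hmax
  have hneg : IsLocalMax (fun t => w (-t) - H (-t) + η * |-t|) 0 := by
    have : Tendsto (fun t : ℝ => -t) (𝓝 0) (𝓝 0) := by
      simpa using (continuous_neg (G := ℝ)).tendsto 0
    have h := this.eventually hmax
    simpa [IsLocalMax, IsMaxFilter] using! h
  have hsum : HasDerivAt (fun t => H t + H (-t)) 0 0 := by
    have h₀ : HasDerivAt H H' (-(0 : ℝ)) := by simpa using hH
    simpa using! hH.add (h₀.comp (0 : ℝ) (hasDerivAt_neg (0 : ℝ)))
  have hslope : Tendsto (fun t => t⁻¹ * (H t + H (-t) - 2 * H 0)) (𝓝[>] 0) (𝓝 0) := by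
    have h := hsum.tendsto_slope_zero_right
    simpa [two_mul] using h
  have hlim : Tendsto (fun t => 2 * ((w t - w 0) / t) - t⁻¹ * (H t + H (-t) - 2 * H 0) + 2 * η)
      (𝓝[>] 0) (𝓝 (2 * L - 0 + 2 * η)) :=
    ((hw.const_mul 2).sub hslope).add_const _
  have hle : 2 * L - 0 + 2 * η ≤ 0 := by
    refine le_of_tendsto hlim ?_
    filter_upwards [nhdsWithin_le_nhds hmax, nhdsWithin_le_nhds hneg, self_mem_nhdsWithin]
      with t h₁ h₂ (ht : 0 < t)
    simp only [heven, abs_neg, abs_of_pos ht, neg_zero, abs_zero, mul_zero, add_zero] at h₁ h₂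
    have hrw : 2 * ((w t - w 0) / t) - t⁻¹ * (H t + H (-t) - 2 * H 0) + 2 * η =
        (2 * (w t - w 0) - (H t + H (-t) - 2 * H 0) + 2 * η * t) / t := by
      field_simp
    rw [hrw]
    exact div_nonpos_of_nonpos_of_nonneg (by linarith) ht.le
  linarith

/-- Real parts of complex polynomials are uniformly dense in the real continuous functions on the
unit circle. -/
theorem exists_polynomial_re_sub_le (F : C(Circle, ℝ)) {ε : ℝ} (hε : 0 < ε) :
    ∃ P : Polynomial ℂ, ∀ c : Circle, |(P.eval (c : ℂ)).re - F c| ≤ ε := by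
  have : Fact (0 < 2 * Real.pi) := ⟨Real.two_pi_pos⟩
  let G : C(AddCircle (2 * Real.pi), ℂ) :=
    ⟨fun x => (F x.toCircle : ℂ), by
      have := AddCircle.continuous_toCircle (T := 2 * Real.pi)
      fun_prop⟩
  have hG : G ∈ (Submodule.span ℂ (range <| @fourier (2 * Real.pi))).topologicalClosure := by
    rw [span_fourier_closure_eq_top]; trivial
  obtain ⟨g, hg, hdist⟩ := Metric.mem_closure_iff.1 hG ε hε
  have hrep : ∃ P Q : Polynomial ℂ, ∀ x : AddCircle (2 * Real.pi),
      g x = P.eval (x.toCircle : ℂ) + (starRingEnd ℂ) (Q.eval (x.toCircle : ℂ)) := by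
    refine Submodule.span_induction (p := fun g _ => ∃ P Q : Polynomial ℂ,
      ∀ x : AddCircle (2 * Real.pi),
      g x = P.eval (x.toCircle : ℂ) + (starRingEnd ℂ) (Q.eval (x.toCircle : ℂ))) ?_ ?_ ?_ ?_ hg
    · rintro _ ⟨n, rfl⟩
      obtain ⟨k, rfl | rfl⟩ := n.eq_nat_or_neg
      · refine ⟨Polynomial.X ^ k, 0, fun x => ?_⟩
        simp [fourier_apply, AddCircle.toCircle_nsmul]
      · refine ⟨0, Polynomial.X ^ k, fun x => ?_⟩
        rw [fourier_neg]
        simp [fourier_apply, AddCircle.toCircle_nsmul]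
    · exact ⟨0, 0, fun x => by simp⟩
    · rintro g₁ g₂ - - ⟨P₁, Q₁, h₁⟩ ⟨P₂, Q₂, h₂⟩
      refine ⟨P₁ + P₂, Q₁ + Q₂, fun x => ?_⟩
      simp only [ContinuousMap.add_apply, h₁, h₂, Polynomial.eval_add, map_add]
      ring
    · rintro a g - ⟨P, Q, h⟩
      refine ⟨Polynomial.C a * P, Polynomial.C ((starRingEnd ℂ) a) * Q, fun x => ?_⟩
      simp [h, mul_add]
  obtain ⟨P, Q, hPQ⟩ := hrep
  refine ⟨P + Q, fun c => ?_⟩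
  obtain ⟨x, rfl⟩ : ∃ x : AddCircle (2 * Real.pi), x.toCircle = c :=
    ⟨_, by rw [← AddCircle.homeomorphCircle_apply Real.two_pi_pos.ne', Homeomorph.apply_symm_apply]⟩
  have hre : ((P + Q).eval (x.toCircle : ℂ)).re - F x.toCircle = (g x - G x).re := by
    simp [hPQ, G]
  rw [hre]
  calc |(g x - G x).re| ≤ ‖g x - G x‖ := Complex.abs_re_le_norm _
    _ = dist (G x) (g x) := by rw [dist_comm, dist_eq_norm]
    _ ≤ dist G g := ContinuousMap.dist_apply_le_dist x
    _ ≤ ε := hdist.le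

theorem average_rePoly (Q : Polynomial ℂ) (z : ℝ × ℝ) (r : ℝ) :
    (2 * Real.pi)⁻¹ * ∫ t in (0:ℝ)..(2 * Real.pi),
      rePoly Q (z.1 + r * Real.cos t, z.2 + r * Real.sin t) = rePoly Q z := by
  have hd : Differentiable ℂ (fun w : ℂ => Q.eval w) := Q.differentiable
  have havg : Real.circleAverage (fun w => Q.eval w) ((z.1 : ℂ) + z.2 * Complex.I) r =
      Q.eval ((z.1 : ℂ) + z.2 * Complex.I) := hd.diffContOnCl.circleAverage
  have hcont : Continuous fun t : ℝ => Q.eval (circleMap ((z.1 : ℂ) + z.2 * Complex.I) r t) :=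
    Q.continuous.comp (continuous_circleMap _ _)
  have hre := congrArg Complex.re havg
  rw [Real.circleAverage_def, Complex.smul_re, smul_eq_mul, ← Complex.reCLM_apply,
    ← ContinuousLinearMap.intervalIntegral_comp_comm _ (hcont.intervalIntegrable _ _)] at hre
  rw [rePoly, ← hre]
  congr 2
  funext t
  simp only [rePoly, circleMap, Complex.reCLM_apply, Complex.exp_mul_I]
  congr 2
  push_cast
  ring

/-- `f` is touched from below at `p` by a function which is harmonic at `p` if `p` lies off the
axis, and which is even in the second variable with nonnegative upper vertical slope if `p` lies
on the axis. -/
def TouchedFromBelow (f : ℝ × ℝ → ℝ) (p : ℝ × ℝ) : Prop :=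
  ∃ W : ℝ × ℝ → ℝ, (∀ x, W x ≤ f x) ∧ W p = f p ∧
    (p.2 ≠ 0 → ContDiffAt ℝ 2 W p ∧ lap2 W p = 0) ∧
    (p.2 = 0 → (∀ t, W (p.1, -t) = W (p.1, t)) ∧ ∃ L, 0 ≤ L ∧
      Tendsto (fun t => (W (p.1, t) - W (p.1, 0)) / t) (𝓝[>] 0) (𝓝 L))

theorem not_isLocalMax_of_touchedFromBelow {f : ℝ × ℝ → ℝ} {p : ℝ × ℝ}
    (hf : TouchedFromBelow f p) (Q : Polynomial ℂ) {δ η : ℝ} (hδ : 0 < δ) (hη : 0 < η)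
    (z : ℝ × ℝ) :
    ¬ IsLocalMax (fun x => f x - rePoly Q x + δ * ((x.1 - z.1) ^ 2 + (x.2 - z.2) ^ 2)
      + η * |x.2|) p := by
  intro hmax
  obtain ⟨W, hWf, hWp, hoff, hon⟩ := hf
  have hpoly := contDiff_rePoly Q
  by_cases hp : p.2 = 0
  · obtain ⟨heven, L, hL, hlim⟩ := hon hp
    let H : ℝ × ℝ → ℝ := fun x => rePoly Q x - δ * ((x.1 - z.1) ^ 2 + (x.2 - z.2) ^ 2)
    have hH : ContDiff ℝ 2 H := by fun_prop
    have hHd : DifferentiableAt ℝ (fun t => H (p.1, t)) 0 := by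
      have : ContDiff ℝ 2 (fun t : ℝ => H (p.1, t)) := hH.comp (by fun_prop)
      exact (this.differentiable (by norm_num)) 0
    refine not_isLocalMax_of_even (w := fun t => W (p.1, t)) hη heven hL hlim hHd.hasDerivAt ?_
    have hp' : ((p.1, (0 : ℝ)) : ℝ × ℝ) = p := by rw [← hp]
    have hline := IsLocalMax.comp_continuous (g := fun t : ℝ => (p.1, t)) (b := 0)
      (by rw [hp']; exact hmax) (by fun_prop)
    filter_upwards [hline] with t ht
    simp only [Function.comp, hp', hWp, abs_zero, H] at ht ⊢
    have := hWf (p.1, t)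
    rw [hp]
    linarith
  · obtain ⟨hWd, hWl⟩ := hoff hp
    obtain ⟨s, hs, hsp⟩ : ∃ s : ℝ, |s| = 1 ∧ s * p.2 = |p.2| := by
      rcases lt_or_gt_of_ne hp with h | h
      · exact ⟨-1, by simp, by rw [abs_of_neg h]; ring⟩
      · exact ⟨1, by simp, by rw [abs_of_pos h]; ring⟩
    let q : ℝ × ℝ → ℝ := fun x => δ * ((x.1 - z.1) ^ 2 + (x.2 - z.2) ^ 2) + (η * s) * x.2 + 0
    have hq : ContDiff ℝ 2 q := by fun_prop
    have hR : ContDiff ℝ 2 (fun x => rePoly Q x - q x) := hpoly.sub hq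
    have hle : lap2 (fun x => W x - (rePoly Q x - q x)) p ≤ 0 := by
      refine lap2_nonpos_of_isLocalMax (hWd.sub hR.contDiffAt) ?_
      filter_upwards [hmax] with x hx
      have h₁ := hWf x
      have h₂ : s * x.2 ≤ |x.2| := by
        calc s * x.2 ≤ |s * x.2| := le_abs_self _
          _ = |x.2| := by rw [abs_mul, hs, one_mul]
      have h₃ := mul_le_mul_of_nonneg_left h₂ hη.le
      simp only [hWp, q, mul_assoc, hsp]
      linarith
    rw [lap2_sub hWd hR.contDiffAt, lap2_sub hpoly.contDiffAt hq.contDiffAt, hWl, lap2_rePoly,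
      lap2_quadratic] at hle
    linarith

/-- Comparison with harmonic polynomials on a disc. -/
theorem le_rePoly_of_touchedFromBelow {f : ℝ × ℝ → ℝ} {z : ℝ × ℝ} {r : ℝ} (hr : 0 < r)
    (hcont : ContinuousOn f {p | (p.1 - z.1) ^ 2 + (p.2 - z.2) ^ 2 ≤ r ^ 2})
    (htouch : ∀ p : ℝ × ℝ, (p.1 - z.1) ^ 2 + (p.2 - z.2) ^ 2 < r ^ 2 → TouchedFromBelow f p)
    (Q : Polynomial ℂ)
    (hbd : ∀ p : ℝ × ℝ, (p.1 - z.1) ^ 2 + (p.2 - z.2) ^ 2 = r ^ 2 → f p ≤ rePoly Q p) :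
    f z ≤ rePoly Q z := by
  by_contra! hlt
  set K : Set (ℝ × ℝ) := {p | (p.1 - z.1) ^ 2 + (p.2 - z.2) ^ 2 ≤ r ^ 2} with hK
  set m := f z - rePoly Q z with hm
  have hmpos : 0 < m := sub_pos.2 hlt
  have hcoord : ∀ p ∈ K, |p.1 - z.1| ≤ r ∧ |p.2 - z.2| ≤ r := fun p hp =>
    ⟨abs_le_of_sq_le_sq (by nlinarith [hp.out, sq_nonneg (p.2 - z.2)]) hr.le,
      abs_le_of_sq_le_sq (by nlinarith [hp.out, sq_nonneg (p.1 - z.1)]) hr.le⟩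
  have hcompact : IsCompact K := by
    refine Metric.isCompact_of_isClosed_isBounded ?_ ?_
    · exact isClosed_le (by fun_prop) (by fun_prop)
    · refine Metric.isBounded_closedBall.subset (fun p hp => ?_ : K ⊆ Metric.closedBall z r)
      rw [Metric.mem_closedBall, Prod.dist_eq]
      exact max_le (hcoord p hp).1 (hcoord p hp).2
  have hz : z ∈ K := by simp [hK, sq_nonneg]
  set δ := m / (4 * r ^ 2) with hδ
  have hδr : δ * r ^ 2 = m / 4 := by rw [hδ]; field_simp
  set A := |z.2| + r with hA
  have hApos : 0 < A := by positivity
  set η := m / (4 * A) with hη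
  have hηA : η * A = m / 4 := by rw [hη]; field_simp
  have hδpos : 0 < δ := by positivity
  have hηpos : 0 < η := by positivity
  obtain ⟨p, hpK, hpmax⟩ := hcompact.exists_isMaxOn
    (f := fun x => f x - rePoly Q x + δ * ((x.1 - z.1) ^ 2 + (x.2 - z.2) ^ 2) + η * |x.2|)
    ⟨z, hz⟩ (((hcont.sub (contDiff_rePoly Q).continuous.continuousOn).add
      (by fun_prop)).add (by fun_prop))
  have hint : (p.1 - z.1) ^ 2 + (p.2 - z.2) ^ 2 < r ^ 2 := by
    refine lt_of_le_of_ne hpK fun heq => ?_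
    have h₁ := hpmax hz
    have h₂ := hbd p heq
    have h₃ : |p.2| ≤ A := by
      have h₄ := (hcoord p hpK).2
      have h₅ := abs_add_le (p.2 - z.2) z.2
      rw [sub_add_cancel] at h₅
      linarith
    have h₄ := mul_le_mul_of_nonneg_left h₃ hηpos.le
    have h₅ : 0 ≤ η * |z.2| := by positivity
    simp only [mem_ofPred_eq, heq, sub_self] at h₁
    rw [hδr] at h₁
    norm_num at h₁
    linarith
  refine not_isLocalMax_of_touchedFromBelow (htouch p hint) Q hδpos hηpos z (hpmax.isLocalMax ?_)
  have hopen : IsOpen {p : ℝ × ℝ | (p.1 - z.1) ^ 2 + (p.2 - z.2) ^ 2 < r ^ 2} :=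
    isOpen_lt (by fun_prop) (by fun_prop)
  exact mem_of_superset (hopen.mem_nhds hint) fun x hx => le_of_lt (mem_ofPred_eq ▸ hx)

theorem submean_of_touchedFromBelow {f : ℝ × ℝ → ℝ} {z : ℝ × ℝ} {r : ℝ} (hr : 0 < r)
    (hcont : ContinuousOn f {p | (p.1 - z.1) ^ 2 + (p.2 - z.2) ^ 2 ≤ r ^ 2})
    (htouch : ∀ p : ℝ × ℝ, (p.1 - z.1) ^ 2 + (p.2 - z.2) ^ 2 < r ^ 2 → TouchedFromBelow f p) :
    f z ≤ (2 * Real.pi)⁻¹ * ∫ t in (0:ℝ)..(2 * Real.pi),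
      f (z.1 + r * Real.cos t, z.2 + r * Real.sin t) := by
  have hmem : ∀ c : Circle, ((z.1 + r * (c : ℂ).re, z.2 + r * (c : ℂ).im) : ℝ × ℝ) ∈
      {p : ℝ × ℝ | (p.1 - z.1) ^ 2 + (p.2 - z.2) ^ 2 ≤ r ^ 2} := fun c => by
    have h := Circle.normSq_coe c
    rw [Complex.normSq_apply] at h
    rw [mem_ofPred_eq]
    apply le_of_eq
    linear_combination r ^ 2 * h
  let F : C(Circle, ℝ) := ⟨fun c => f (z.1 + r * (c : ℂ).re, z.2 + r * (c : ℂ).im),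
    hcont.comp_continuous (by fun_prop) hmem⟩
  have hFexp : ∀ t : ℝ, F (Circle.exp t) = f (z.1 + r * Real.cos t, z.2 + r * Real.sin t) := by
    intro t
    simp [F, Complex.exp_ofReal_mul_I_re, Complex.exp_ofReal_mul_I_im]
  have hfcont : Continuous fun t : ℝ => f (z.1 + r * Real.cos t, z.2 + r * Real.sin t) := by
    simp only [← hFexp]
    fun_prop
  refine le_of_forall_pos_le_add fun ε hε => ?_
  obtain ⟨P, hP⟩ := exists_polynomial_re_sub_le F (half_pos hε)
  set ζ : ℂ := (z.1 : ℂ) + z.2 * Complex.I with hζ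
  let Q : Polynomial ℂ := (P + Polynomial.C ((ε / 2 : ℝ) : ℂ)).comp
    (Polynomial.C ((r : ℂ)⁻¹) * (Polynomial.X - Polynomial.C ζ))
  have hr' : (r : ℂ) ≠ 0 := by exact_mod_cast hr.ne'
  have hQ : ∀ c : Circle, rePoly Q (z.1 + r * (c : ℂ).re, z.2 + r * (c : ℂ).im) =
      (P.eval (c : ℂ)).re + ε / 2 := by
    intro c
    have harg : (r : ℂ)⁻¹ * (((z.1 + r * (c : ℂ).re : ℝ) : ℂ) +
        ((z.2 + r * (c : ℂ).im : ℝ) : ℂ) * Complex.I - ζ) = c := by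
      rw [inv_mul_eq_iff_eq_mul₀ hr', hζ]
      conv_rhs => rw [← Complex.re_add_im (c : ℂ)]
      push_cast
      ring
    simp only [rePoly, Q, Polynomial.eval_comp, Polynomial.eval_mul, Polynomial.eval_C,
      Polynomial.eval_sub, Polynomial.eval_X, harg, Polynomial.eval_add, Complex.add_re,
      Complex.ofReal_re]
  have hz : f z ≤ rePoly Q z := by
    refine le_rePoly_of_touchedFromBelow hr hcont htouch Q fun p hp => ?_
    have hnorm : ‖(⟨(p.1 - z.1) / r, (p.2 - z.2) / r⟩ : ℂ)‖ = 1 := by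
      rw [← sq_eq_sq₀ (norm_nonneg _) zero_le_one, ← Complex.normSq_eq_norm_sq,
        Complex.normSq_mk]
      field_simp
      linarith
    obtain ⟨c, hc⟩ : ∃ c : Circle, (c : ℂ) = ⟨(p.1 - z.1) / r, (p.2 - z.2) / r⟩ :=
      ⟨⟨_, mem_sphere_zero_iff_norm.2 hnorm⟩, rfl⟩
    have hpc : ((z.1 + r * (c : ℂ).re, z.2 + r * (c : ℂ).im) : ℝ × ℝ) = p := by
      rw [hc]
      ext <;> simp <;> field_simp <;> ring
    rw [← hpc, hQ]
    have := (abs_le.1 (hP c)).1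
    change F c ≤ _
    linarith
  have hQexp : ∀ t : ℝ, rePoly Q (z.1 + r * Real.cos t, z.2 + r * Real.sin t) =
      (P.eval (Circle.exp t : ℂ)).re + ε / 2 := by
    intro t
    rw [← hQ]
    simp [Complex.exp_ofReal_mul_I_re, Complex.exp_ofReal_mul_I_im]
  have hQcont : Continuous fun t : ℝ =>
      rePoly Q (z.1 + r * Real.cos t, z.2 + r * Real.sin t) :=
    (contDiff_rePoly Q).continuous.comp (by fun_prop)
  have hint : ∫ t in (0:ℝ)..(2 * Real.pi),
        rePoly Q (z.1 + r * Real.cos t, z.2 + r * Real.sin t) ≤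
      ∫ t in (0:ℝ)..(2 * Real.pi), (f (z.1 + r * Real.cos t, z.2 + r * Real.sin t) + ε) := by
    refine intervalIntegral.integral_mono_on Real.two_pi_pos.le
      (hQcont.intervalIntegrable _ _) ((hfcont.add continuous_const).intervalIntegrable _ _)
      fun t _ => ?_
    rw [hQexp, ← hFexp]
    have := (abs_le.1 (hP (Circle.exp t))).2
    linarith
  rw [intervalIntegral.integral_add (hfcont.intervalIntegrable _ _)
    (continuous_const.intervalIntegrable _ _), intervalIntegral.integral_const] at hint
  calc f z ≤ rePoly Q z := hz
    _ = _ := (average_rePoly Q z r).symm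
    _ ≤ _ := mul_le_mul_of_nonneg_left hint (by positivity)
    _ = _ := by
      rw [mul_add, smul_eq_mul, sub_zero, inv_mul_cancel_left₀ Real.two_pi_pos.ne']

theorem isOpen_ball1 : IsOpen ball1 := isOpen_lt (by fun_prop) (by fun_prop)

theorem ThinObstacleSol.harmonic_off_axis {φ : ℝ → ℝ} {u : ℝ × ℝ → ℝ}
    (hu : ThinObstacleSol φ u) {p : ℝ × ℝ} (hp : p ∈ ball1) (hp2 : p.2 ≠ 0) :
    ContDiffAt ℝ 2 u p ∧ lap2 u p = 0 := by
  have hopen : IsOpen (ball1 ∩ {x : ℝ × ℝ | x.2 ≠ 0}) :=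
    isOpen_ball1.inter (isOpen_ne_fun (by fun_prop) (by fun_prop))
  exact ⟨hu.1.1.contDiffAt (mem_of_superset (hopen.mem_nhds ⟨hp, hp2⟩)
    fun x hx => ⟨hx.1, fun h => hx.2 h.1⟩), hu.1.2 p ⟨hp, fun h => hp2 h.1⟩⟩

theorem touchedFromBelow_max_sub {φu φv : ℝ → ℝ} {u v : ℝ × ℝ → ℝ}
    (hu_even : ∀ p : ℝ × ℝ, u (p.1, -p.2) = u p)
    (hv_even : ∀ p : ℝ × ℝ, v (p.1, -p.2) = v p)
    (hu : ThinObstacleSol φu u) (hv : ThinObstacleSol φv v)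
    (hobst : ∀ x₁ ∈ Set.Ioo (-1:ℝ) 1, u (x₁, 0) = φu x₁ → φu x₁ ≤ φv x₁)
    {p : ℝ × ℝ} (hp : p ∈ ball1) :
    TouchedFromBelow (fun x => max (u x - v x) 0) p := by
  rcases le_or_gt (u p - v p) 0 with hle | hpos
  · refine ⟨fun _ => 0, fun x => le_max_right _ _, (max_eq_right hle).symm,
      fun _ => ⟨contDiffAt_const, by simp [lap2]⟩, fun _ => ⟨fun _ => rfl, 0, le_rfl, by simp⟩⟩
  · refine ⟨fun x => u x - v x, fun x => le_max_left _ _, (max_eq_left hpos.le).symm, ?_, ?_⟩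
    · intro h
      obtain ⟨hud, hul⟩ := hu.harmonic_off_axis hp h
      obtain ⟨hvd, hvl⟩ := hv.harmonic_off_axis hp h
      exact ⟨hud.sub hvd, by rw [lap2_sub hud hvd, hul, hvl, sub_zero]⟩
    · intro h
      obtain ⟨a, b⟩ := p
      obtain rfl : b = 0 := h
      have ha : a ∈ Set.Ioo (-1 : ℝ) 1 := by
        rw [mem_Ioo, ← abs_lt, ← sq_lt_one_iff_abs_lt_one]
        simpa [ball1] using hp
      refine ⟨fun t => congrArg₂ (· - ·) (hu_even (a, t)) (hv_even (a, t)), ?_⟩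
      obtain ⟨Lu, hLu, -, hLu0⟩ := hu.2.2 a ha
      obtain ⟨Lv, hLv, hLv0, -⟩ := hv.2.2 a ha
      have hnot : φu a < u (a, 0) := by
        refine lt_of_le_of_ne (hu.2.1 a ha) fun heq => ?_
        have h₁ := hobst a ha heq.symm
        have h₂ := hv.2.1 a ha
        linarith
      refine ⟨Lu - Lv, by rw [hLu0 hnot]; linarith, ?_⟩
      refine (hLu.sub hLv).congr fun t => ?_
      ring

/-- Comparison principle for the thin obstacle problem: if `u, v` are
continuous on `B₁`, even in `x₂`, solve the thin obstacle problem with obstacles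
`φ_u, φ_v` respectively, and `φ_u ≤ φ_v` on the contact set of `u`, then `(u − v)₊` is
subharmonic in `B₁` in the sense of the sub-mean value property on circles. -/
theorem statement6
    (φu φv : ℝ → ℝ) (hφu : ContinuousOn φu (Set.Ioo (-1:ℝ) 1))
    (hφv : ContinuousOn φv (Set.Ioo (-1:ℝ) 1))
    (u v : ℝ × ℝ → ℝ)
    (hu_cont : ContinuousOn u ball1) (hv_cont : ContinuousOn v ball1)
    (hu_even : ∀ p : ℝ × ℝ, u (p.1, -p.2) = u p)
    (hv_even : ∀ p : ℝ × ℝ, v (p.1, -p.2) = v p)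
    (hu : ThinObstacleSol φu u) (hv : ThinObstacleSol φv v)
    (hobst : ∀ x₁ ∈ Set.Ioo (-1:ℝ) 1, u (x₁, 0) = φu x₁ → φu x₁ ≤ φv x₁) :
    ∀ z ∈ ball1, ∀ r > 0,
      {p : ℝ × ℝ | (p.1 - z.1)^2 + (p.2 - z.2)^2 ≤ r^2} ⊆ ball1 →
      max (u z - v z) 0 ≤ (2 * Real.pi)⁻¹ *
        ∫ t in (0:ℝ)..(2 * Real.pi),
          max (u (z.1 + r * Real.cos t, z.2 + r * Real.sin t)
               - v (z.1 + r * Real.cos t, z.2 + r * Real.sin t)) 0 := by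
  intro z _ r hr hsub
  refine submean_of_touchedFromBelow (f := fun x => max (u x - v x) 0) hr ?_ fun p hp =>
    touchedFromBelow_max_sub hu_even hv_even hu hv hobst (hsub (le_of_lt hp))
  exact ((hu_cont.sub hv_cont).sup continuousOn_const).mono hsub
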